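/- Let n ≥ 7 and let G and H be simple graphs on n vertices that share n−1 cards, with Δ(G) ≤ n−3. If κ_r(G) ≠ κ_r(H) for some integer r ≥ 2, then the vertices of maximum degree of G have pairwise distinct K_r-degrees, i.e., the map v ↦ deg_r(v,G) is injective on { v ∈ V(G) : deg(v,G) = Δ(G) }. -/

import Mathlib

open SimpleGraph

/-- `kappa G r` is the number of `r`-cliques of the graph `G`. -/
noncomputable def kappa {V : Type*} (G : SimpleGraph V) (r : ℕ) : ℕ :=
  (G.cliqueSet r).ncard

/-- `degR G r v` is the number of `r`-cliques of `G` that contain the vertex `v`. -/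
noncomputable def degR {V : Type*} (G : SimpleGraph V) (r : ℕ) (v : V) : ℕ :=
  {s | s ∈ G.cliqueSet r ∧ v ∈ s}.ncard

/-- `deg G v` is the degree of the vertex `v` in `G`. -/
noncomputable def deg {V : Type*} (G : SimpleGraph V) (v : V) : ℕ :=
  (G.neighborSet v).ncard

/-- `gcard G v` is the card `G - v`: the induced subgraph of `G` on `V(G) \ {v}`. -/
def gcard {V : Type*} (G : SimpleGraph V) (v : V) : SimpleGraph {x : V // x ≠ v} :=
  G.induce {x : V | x ≠ v}

/-- The maximum degree `Δ(G)`. -/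
noncomputable def maxDeg {n : ℕ} (G : SimpleGraph (Fin n)) : ℕ :=
  Finset.univ.sup (fun v => deg G v)

/-- The minimum degree `δ(G)`. -/
noncomputable def minDeg {n : ℕ} (G : SimpleGraph (Fin n)) : ℕ :=
  sInf (Set.range (fun v => deg G v))

/-- `ℓ(G)`: the number of vertices of maximum degree. -/
noncomputable def numMaxDeg {n : ℕ} (G : SimpleGraph (Fin n)) : ℕ :=
  (Finset.univ.filter (fun v => deg G v = maxDeg G)).card

/-- `G` and `H` share `n-1` cards via the vertices `u`, `w` and the bijection `π`:
for every `v ≠ u`, the card `G - v` is isomorphic to the card `H - π(v)`. -/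
def ShareCardsVia {n : ℕ} (G H : SimpleGraph (Fin n)) (u w : Fin n)
    (π : {x : Fin n // x ≠ u} ≃ {y : Fin n // y ≠ w}) : Prop :=
  ∀ v : {x : Fin n // x ≠ u}, Nonempty (gcard G v.1 ≃g gcard H (π v).1)

/-- `G` and `H` share `n-1` cards. -/
def ShareCards {n : ℕ} (G H : SimpleGraph (Fin n)) : Prop :=
  ∃ (u w : Fin n) (π : {x : Fin n // x ≠ u} ≃ {y : Fin n // y ≠ w}),
    ShareCardsVia G H u w π

section Aux
open Finset
open scoped Classical

/-- abstract labelled core argument -/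
theorem aux_core {V : Type*} [Fintype V] (A B : V → V → Prop)
    (sA : ∀ x y, A x y → A y x) (sB : ∀ x y, B x y → B y x) (M : V → Prop)
    (f g : V → ℤ) (u : V) (c : ℤ) (hc : 0 < c) (hg : ∀ v, v ≠ u → g v = f v - c)
    (D : ℕ) (hD : 2 ≤ D)
    (hA : ∀ x, M x → (univ.filter (fun v => A x v)).card = D)
    (hB : ∀ x, M x → (univ.filter (fun v => B x v)).card = D)
    (hvis : ∀ v, v ≠ u → ∀ t, (univ.filter (fun x => M x ∧ A x v ∧ f x = t)).card
      = (univ.filter (fun x => M x ∧ B x v ∧ g x = t)).card)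
    (hopen : ∀ v, v ≠ u → M v → ∃ x, A v x ∧ ¬ M x) :
    ∀ x y, M x → M y → f x = f y → x = y := by
  have other : ∀ (R : V → V → Prop) x, (univ.filter (fun v => R x v)).card = D →
      ∃ v, v ≠ u ∧ R x v := by
    intro R x h
    obtain ⟨v, hv, hne⟩ := Finset.exists_mem_ne (by omega : 1 < (univ.filter (fun v => R x v)).card) u
    exact ⟨v, hne, (mem_filter.1 hv).2⟩
  have visAB : ∀ v, v ≠ u → ∀ x, M x → A x v → ∃ y, M y ∧ B y v ∧ g y = f x := by
    intro v hv x hx hxv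
    have : 0 < (univ.filter (fun y => M y ∧ B y v ∧ g y = f x)).card := by
      rw [← hvis v hv]; exact card_pos.2 ⟨x, by simp [hx, hxv]⟩
    obtain ⟨y, hy⟩ := card_pos.1 this
    exact ⟨y, by simpa using hy⟩
  have visBA : ∀ v, v ≠ u → ∀ x, M x → B x v → ∃ y, M y ∧ A y v ∧ f y = g x := by
    intro v hv x hx hxv
    have : 0 < (univ.filter (fun y => M y ∧ A y v ∧ f y = g x)).card := by
      rw [hvis v hv]; exact card_pos.2 ⟨x, by simp [hx, hxv]⟩
    obtain ⟨y, hy⟩ := card_pos.1 this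
    exact ⟨y, by simpa using hy⟩
  have supAB : ∀ x, M x → ∃ y, M y ∧ g y = f x := by
    intro x hx
    obtain ⟨v, hv, h⟩ := other A x (hA x hx)
    obtain ⟨y, h1, -, h2⟩ := visAB v hv x hx h
    exact ⟨y, h1, h2⟩
  have supBA : ∀ x, M x → ∃ y, M y ∧ f y = g x := by
    intro x hx
    obtain ⟨v, hv, h⟩ := other B x (hB x hx)
    obtain ⟨y, h1, -, h2⟩ := visBA v hv x hx h
    exact ⟨y, h1, h2⟩
  by_contra hcon
  push Not at hcon
  obtain ⟨x1, y1, hx1, hy1, hf1, hne1⟩ := hcon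
  -- minimiser of f on M
  have hMne : (univ.filter M).Nonempty := ⟨x1, by simp [hx1]⟩
  have minu : ∀ x, M x → (∀ y, M y → f x ≤ f y) → x = u := by
    intro x hx hmin
    by_contra hne
    obtain ⟨y, hy, hy'⟩ := supBA x hx
    have := hmin y hy
    have := hg x hne
    omega
  have maxu : ∀ x, M x → (∀ y, M y → g y ≤ g x) → x = u := by
    intro x hx hmax
    by_contra hne
    obtain ⟨y, hy, hy'⟩ := supAB x hx
    have := hmax y hy
    have := hg x hne
    omega
  obtain ⟨a, ha, hamin⟩ := exists_min_image (univ.filter M) f hMne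
  obtain ⟨b, hb, hbmax⟩ := exists_max_image (univ.filter M) g hMne
  simp only [mem_filter, mem_univ, true_and] at ha hb hamin hbmax
  have hau := minu a ha hamin
  have hbu := maxu b hb hbmax
  subst hau
  subst hbu
  -- strict minimality
  have smin : ∀ x, M x → x ≠ b → f b < f x := by
    intro x hx hne
    refine lt_of_le_of_ne (hamin x hx) fun h => hne (minu x hx fun y hy => h ▸ hamin y hy)
  have smax : ∀ x, M x → x ≠ b → g x < g b := by
    intro x hx hne
    refine lt_of_le_of_ne (hbmax x hx) fun h => hne (maxu x hx fun y hy => h ▸ hbmax y hy)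
  -- minimal counterexample
  obtain ⟨x, hx, hxmin⟩ := exists_min_image
    (univ.filter (fun x => M x ∧ ∃ y, M y ∧ f x = f y ∧ x ≠ y)) f
    ⟨x1, by simp only [mem_filter, mem_univ, true_and]; exact ⟨hx1, y1, hy1, hf1, hne1⟩⟩
  simp only [mem_filter, mem_univ, true_and] at hx hxmin
  obtain ⟨hxM, y, hyM, hfxy, hxy⟩ := hx
  have hxb : x ≠ b := by
    rintro rfl
    have := smin y hyM (Ne.symm hxy); omega
  have hyb : y ≠ b := by
    rintro rfl
    have := smin x hxM hxy; omega
  have hgx := hg x hxb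
  have hgy := hg y hyb
  set t := f x - c with ht
  have mG : (univ.filter (fun z => M z ∧ f z = t)).card ≤ 1 := by
    rw [card_le_one]
    intro p hp q hq
    simp only [mem_filter, mem_univ, true_and] at hp hq
    by_contra hpq
    have := hxmin p ⟨hp.1, q, hq.1, by omega, hpq⟩
    omega
  have mH : 2 ≤ (univ.filter (fun z => M z ∧ g z = t)).card := by
    have : 1 < (univ.filter (fun z => M z ∧ g z = t)).card := by
      rw [one_lt_card]
      exact ⟨x, by simp [hxM, hgx], y, by simp only [mem_filter, mem_univ, true_and]; exact ⟨hyM, by omega⟩, hxy⟩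
    omega
  have sumf : ∀ (R : V → V → Prop) (l : V → ℤ),
      (∀ x, M x → (univ.filter (fun v => R x v)).card = D) →
      ∑ v, (univ.filter (fun z => M z ∧ R z v ∧ l z = t)).card
        = (univ.filter (fun z => M z ∧ l z = t)).card * D := by
    intro R l hR
    have := sum_card_bipartiteAbove_eq_sum_card_bipartiteBelow
      (s := univ.filter (fun z => M z ∧ l z = t)) (t := (univ : Finset V)) R
    rw [Finset.sum_const_nat (m := D)] at this
    · rw [this]
      refine sum_congr rfl fun v _ => ?_
      congr 1
      ext z
      simp only [bipartiteBelow, mem_filter, mem_univ, true_and]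
      tauto
    · intro z hz
      exact hR z (by simpa using (mem_filter.1 hz).2.1)
  have s1 := sumf A f hA
  have s2 := sumf B g hB
  rw [← add_sum_erase univ _ (mem_univ b)] at s1 s2
  have s3 : ∑ v ∈ univ.erase b, (univ.filter (fun z => M z ∧ A z v ∧ f z = t)).card
      = ∑ v ∈ univ.erase b, (univ.filter (fun z => M z ∧ B z v ∧ g z = t)).card :=
    sum_congr rfl fun v hv => hvis v (ne_of_mem_erase hv) t
  have hwt : D ≤ (univ.filter (fun z => M z ∧ B z b ∧ g z = t)).card := by
    nlinarith [Nat.mul_le_mul_right D mG, Nat.mul_le_mul_right D mH]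
  have hclosed : ∀ z, B b z → M z := by
    have hsub : univ.filter (fun z => M z ∧ B z b ∧ g z = t) ⊆ univ.filter (fun z => B b z) := by
      intro z hz
      simp only [mem_filter, mem_univ, true_and] at hz ⊢
      exact sB _ _ hz.2.1
    have := eq_of_subset_of_card_le hsub (by rw [hB b hb]; exact hwt)
    intro z hz
    have hz' : z ∈ univ.filter (fun z => B b z) := by simp [hz]
    rw [← this] at hz'
    exact (mem_filter.1 hz').2.1
  obtain ⟨v, hv, hvb⟩ := supBA b hb
  have hvne : v ≠ b := by
    rintro rfl
    obtain ⟨y', hy', hy''⟩ := supAB x hxM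
    have := hbmax y' hy'
    have := smin x hxM hxb
    omega
  obtain ⟨z, hz, hzM⟩ := hopen v hvne hv
  have hzb : z ≠ b := by rintro rfl; exact hzM hb
  obtain ⟨p, hp, hpz, hgp⟩ := visAB z hzb v hv hz
  have hpb : p = b := by
    by_contra h
    have := smax p hp h
    omega
  subst hpb
  exact hzM (hclosed z hpz)

/-- sharing in normalised form -/
def AuxSh {V : Type*} (G H : SimpleGraph V) (u : V) : Prop :=
  ∀ v, v ≠ u → ∃ τ : Equiv.Perm V, τ v = v ∧
    ∀ x y, x ≠ v → y ≠ v → (G.Adj x y ↔ H.Adj (τ x) (τ y))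

theorem AuxSh.flip {V : Type*} {G H : SimpleGraph V} {u : V} (h : AuxSh G H u) : AuxSh H G u := by
  intro v hv
  obtain ⟨τ, h1, h2⟩ := h v hv
  have h3 : τ.symm v = v := by rw [Equiv.symm_apply_eq, h1]
  refine ⟨τ.symm, h3, fun x y hx hy => ?_⟩
  rw [h2]
  · simp
  · intro h; apply hx; rw [Equiv.symm_apply_eq] at h; rw [h, h1]
  · intro h; apply hy; rw [Equiv.symm_apply_eq] at h; rw [h, h1]

noncomputable def dg {V : Type*} [Fintype V] (G : SimpleGraph V) (v : V) : ℕ :=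
  (univ.filter (fun x => G.Adj v x)).card

noncomputable def cdg {V : Type*} [Fintype V] (G : SimpleGraph V) (v x : V) : ℕ :=
  (univ.filter (fun y => G.Adj x y ∧ y ≠ v)).card

noncomputable def kp {V : Type*} [Fintype V] (G : SimpleGraph V) (r : ℕ) : ℕ :=
  (univ.filter (fun s : Finset V => G.IsNClique r s)).card

noncomputable def dr {V : Type*} [Fintype V] (G : SimpleGraph V) (r : ℕ) (v : V) : ℕ :=
  (univ.filter (fun s : Finset V => G.IsNClique r s ∧ v ∈ s)).card

theorem cdg_adj {V : Type*} [Fintype V] (G : SimpleGraph V) (v x : V) (h : G.Adj x v) :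
    cdg G v x + 1 = dg G x := by
  have : univ.filter (fun y => G.Adj x y ∧ y ≠ v) = (univ.filter (fun y => G.Adj x y)).erase v := by
    ext y; simp [and_comm]
  unfold cdg dg
  rw [this, card_erase_add_one (by simp [h])]

theorem cdg_nadj {V : Type*} [Fintype V] (G : SimpleGraph V) (v x : V) (h : ¬ G.Adj x v) :
    cdg G v x = dg G x := by
  unfold cdg dg
  congr 1
  ext y
  simp only [mem_filter, mem_univ, true_and, and_iff_left_iff_imp]
  rintro h1 rfl; exact h h1

theorem perm_ne {V : Type*} {τ : Equiv.Perm V} {v x : V} (h : τ v = v) : τ x ≠ v ↔ x ≠ v := by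
  rw [not_iff_not]
  constructor
  · intro h'; exact τ.injective (h'.trans h.symm)
  · rintro rfl; exact h

theorem cdg_eq {V : Type*} [Fintype V] {G H : SimpleGraph V} {v : V} {τ : Equiv.Perm V}
    (h1 : τ v = v) (h2 : ∀ x y, x ≠ v → y ≠ v → (G.Adj x y ↔ H.Adj (τ x) (τ y)))
    {x : V} (hx : x ≠ v) : cdg G v x = cdg H v (τ x) := by
  unfold cdg
  refine card_equiv τ fun y => ?_
  simp only [mem_filter, mem_univ, true_and, perm_ne h1]
  constructor
  · rintro ⟨a, b⟩; exact ⟨(h2 x y hx b).1 a, b⟩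
  · rintro ⟨a, b⟩; exact ⟨(h2 x y hx b).2 a, b⟩

theorem clique_map {V : Type*} [Fintype V] {G H : SimpleGraph V} {P : V → Prop} {τ : Equiv.Perm V}
    (h2 : ∀ x y, P x → P y → (G.Adj x y ↔ H.Adj (τ x) (τ y)))
    (r : ℕ) (s : Finset V) (hs : ∀ x ∈ s, P x) :
    G.IsNClique r s ↔ H.IsNClique r (s.map τ.toEmbedding) := by
  simp only [isNClique_iff, card_map]
  refine and_congr_left fun _ => ?_
  simp only [isClique_iff, Set.Pairwise, mem_coe, mem_map, Equiv.coe_toEmbedding,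
    forall_exists_index, and_imp]
  constructor
  · rintro h _ x hx rfl _ y hy rfl hne
    exact (h2 x y (hs x hx) (hs y hy)).1 (h hx hy fun h => hne (h ▸ rfl))
  · intro h x hx y hy hne
    exact (h2 x y (hs x hx) (hs y hy)).2
      (h x hx rfl y hy rfl fun h => hne (τ.injective h))

theorem kp_iso {V : Type*} [Fintype V] {G H : SimpleGraph V} {τ : Equiv.Perm V}
    (h2 : ∀ x y, (G.Adj x y ↔ H.Adj (τ x) (τ y))) (r : ℕ) : kp G r = kp H r := by
  unfold kp
  refine card_equiv (Equiv.finsetCongr τ) fun s => ?_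
  simp only [mem_filter, mem_univ, true_and, Equiv.finsetCongr_apply]
  exact clique_map (P := fun _ => True) (fun x y _ _ => h2 x y) r s (by simp)

theorem kp_card {V : Type*} [Fintype V] {G H : SimpleGraph V} {v : V} {τ : Equiv.Perm V}
    (h1 : τ v = v) (h2 : ∀ x y, x ≠ v → y ≠ v → (G.Adj x y ↔ H.Adj (τ x) (τ y))) (r : ℕ)
    (Q R : Finset V → Prop) (hQ : ∀ s, Q s ↔ R (s.map τ.toEmbedding)) :
    (univ.filter (fun s : Finset V => G.IsNClique r s ∧ v ∉ s ∧ Q s)).card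
     = (univ.filter (fun s : Finset V => H.IsNClique r s ∧ v ∉ s ∧ R s)).card := by
  refine card_equiv (Equiv.finsetCongr τ) fun s => ?_
  simp only [mem_filter, mem_univ, true_and, Equiv.finsetCongr_apply, ← hQ]
  have hv : v ∉ s ↔ v ∉ s.map τ.toEmbedding := by
    rw [not_iff_not, mem_map]
    constructor
    · intro h; exact ⟨v, h, h1⟩
    · rintro ⟨x, hx, hxv⟩
      have : x = v := τ.injective (hxv.trans h1.symm)
      exact this ▸ hx
  rw [← hv]
  constructor
  · rintro ⟨a, b, c⟩
    exact ⟨(clique_map (P := fun x => x ≠ v) h2 r s (fun x hx h => b (h ▸ hx))).1 a, b, c⟩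
  · rintro ⟨a, b, c⟩
    exact ⟨(clique_map (P := fun x => x ≠ v) h2 r s (fun x hx h => b (h ▸ hx))).2 a, b, c⟩

theorem kp_split {V : Type*} [Fintype V] (G : SimpleGraph V) (v : V) (r : ℕ) :
    kp G r = dr G r v +
      (univ.filter (fun s : Finset V => G.IsNClique r s ∧ v ∉ s ∧ True)).card := by
  unfold kp dr
  rw [← card_filter_add_card_filter_not (fun s : Finset V => v ∈ s), filter_filter, filter_filter]
  simp

theorem kp_dr {V : Type*} [Fintype V] {G H : SimpleGraph V} {v : V} {τ : Equiv.Perm V}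
    (h1 : τ v = v) (h2 : ∀ x y, x ≠ v → y ≠ v → (G.Adj x y ↔ H.Adj (τ x) (τ y))) (r : ℕ) :
    kp G r + dr H r v = kp H r + dr G r v := by
  have : (univ.filter (fun s : Finset V => G.IsNClique r s ∧ v ∉ s ∧ True)).card
     = (univ.filter (fun s : Finset V => H.IsNClique r s ∧ v ∉ s ∧ True)).card := by
    convert kp_card h1 h2 r (fun _ => True) (fun _ => True) (by simp)
  have a := kp_split G v r
  have b := kp_split H v r
  omega

theorem dr_nadj {V : Type*} [Fintype V] (G : SimpleGraph V) {v x : V} (hx : x ≠ v)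
    (h : ¬ G.Adj x v) (r : ℕ) :
    dr G r x = (univ.filter (fun s : Finset V => G.IsNClique r s ∧ v ∉ s ∧ x ∈ s)).card := by
  unfold dr
  congr 1
  ext s
  simp only [mem_filter, mem_univ, true_and]
  constructor
  · rintro ⟨a, b⟩
    refine ⟨a, fun hv => h ?_, b⟩
    exact a.isClique (by simpa using b) (by simpa using hv) hx
  · rintro ⟨a, b, c⟩; exact ⟨a, c⟩

theorem dr_card {V : Type*} [Fintype V] {G H : SimpleGraph V} {v : V} {τ : Equiv.Perm V}
    (h1 : τ v = v) (h2 : ∀ x y, x ≠ v → y ≠ v → (G.Adj x y ↔ H.Adj (τ x) (τ y))) (r : ℕ)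
    {x : V} (hx : x ≠ v) (hG : ¬ G.Adj x v) (hH : ¬ H.Adj (τ x) v) :
    dr G r x = dr H r (τ x) := by
  rw [dr_nadj G hx hG, dr_nadj H ((perm_ne h1).2 hx) hH]
  convert kp_card h1 h2 r (fun s => x ∈ s) (fun s => τ x ∈ s) (fun s => by simp)

theorem sum_dg {V : Type*} [Fintype V] (G : SimpleGraph V) : ∃ e, ∑ v, dg G v = 2 * e := by
  refine ⟨G.edgeFinset.card, ?_⟩
  rw [← G.sum_degrees_eq_twice_card_edges]
  refine sum_congr rfl fun v _ => ?_
  rw [dg, ← card_neighborFinset_eq_degree]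
  congr 1
  ext; simp

theorem sum_cdg {V : Type*} [Fintype V] (G : SimpleGraph V) (v : V) :
    ∑ x ∈ univ.erase v, cdg G v x + 2 * dg G v = ∑ x, dg G x := by
  have h : ∀ x, dg G x = cdg G v x + if G.Adj x v then 1 else 0 := by
    intro x
    split_ifs with h
    · rw [← cdg_adj G v x h]
    · rw [cdg_nadj G v x h]; rfl
  have h3 : ∑ x, (if G.Adj x v then 1 else 0) = dg G v := by
    rw [← card_filter]; unfold dg; congr 1; ext x; simp [G.adj_comm x v]
  have h4 : cdg G v v = dg G v := cdg_nadj G v v (by simp)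
  rw [sum_congr rfl fun x _ => h x, sum_add_distrib, h3, ← add_sum_erase univ _ (mem_univ v), h4]
  ring

theorem aux_E0 {V : Type*} [Fintype V] {G H : SimpleGraph V} {u : V} (hS : AuxSh G H u)
    (hn : 7 ≤ Fintype.card V) (hGu : dg G u = 0) (hHu : dg H u + 3 = Fintype.card V)
    (hd : ∀ v, v ≠ u → dg H v + 1 = dg G v) : False := by
  -- non-neighbours of u in H
  have hcard : (univ.filter (fun x => x ≠ u ∧ ¬ H.Adj u x)).card = 2 := by
    have h1 : univ.filter (fun x => x ≠ u ∧ ¬ H.Adj u x)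
        = (univ.filter (fun x => ¬ H.Adj u x)).erase u := by
      ext; simp
    have h2 := card_filter_add_card_filter_not (s := (univ : Finset V)) (fun x => H.Adj u x)
    have h3 := card_erase_add_one (s := univ.filter (fun x => ¬ H.Adj u x)) (a := u) (by simp)
    rw [h1]
    unfold dg at hHu
    rw [card_univ] at h2
    omega
  obtain ⟨y1, y2, hy, hset⟩ := card_eq_two.1 hcard
  have mem : ∀ z, z ≠ u → ¬ H.Adj z u → z = y1 ∨ z = y2 := by
    intro z hz hzu
    have : z ∈ univ.filter (fun x => x ≠ u ∧ ¬ H.Adj u x) := by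
      simp [hz, H.adj_comm u z, hzu]
    rw [hset] at this; simpa using this
  have m1 : y1 ≠ u ∧ ¬ H.Adj u y1 := by
    have : y1 ∈ univ.filter (fun x => x ≠ u ∧ ¬ H.Adj u x) := by rw [hset]; simp
    simpa using this
  have m2 : y2 ≠ u ∧ ¬ H.Adj u y2 := by
    have : y2 ∈ univ.filter (fun x => x ≠ u ∧ ¬ H.Adj u x) := by rw [hset]; simp
    simpa using this
  have hGu' : ∀ y, ¬ G.Adj u y := by
    intro y h
    unfold dg at hGu
    rw [card_eq_zero] at hGu
    have : y ∈ univ.filter (fun x => G.Adj u x) := by simp [h]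
    rw [hGu] at this; simp at this
  have iso : ∀ v, v ≠ u → ∃ z, z ≠ v ∧ (z = y1 ∨ z = y2) ∧ ∀ y, H.Adj z y → y = v := by
    intro v hv
    obtain ⟨τ, h1, h2⟩ := hS v hv
    have c0 : cdg H v (τ u) = 0 := by
      rw [← cdg_eq h1 h2 hv.symm, cdg_nadj G v u (hGu' v), hGu]
    have hz : ∀ y, H.Adj (τ u) y → y = v := by
      intro y hy
      by_contra hne
      unfold cdg at c0
      rw [card_eq_zero] at c0
      have : y ∈ univ.filter (fun y => H.Adj (τ u) y ∧ y ≠ v) := by simp [hy, hne]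
      rw [c0] at this; simp at this
    have hzu : τ u ≠ u := by
      intro h
      rw [h] at c0
      by_cases ha : H.Adj u v
      · have := cdg_adj H v u ha; omega
      · have := cdg_nadj H v u ha; omega
    exact ⟨τ u, (perm_ne h1).2 hv.symm, mem _ hzu fun h => hv (hz u h).symm, hz⟩
  have N2 : ∀ y, H.Adj y2 y → y = y1 := by
    obtain ⟨z, hz, hz' | hz', h⟩ := iso y1 m1.1
    · exact absurd hz' hz
    · exact hz' ▸ h
  have N1 : ∀ y, H.Adj y1 y → y = y2 := by
    obtain ⟨z, hz, hz' | hz', h⟩ := iso y2 m2.1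
    · exact hz' ▸ h
    · exact absurd hz' hz
  obtain ⟨v3, hv3⟩ : ∃ v, v ∉ ({u, y1, y2} : Finset V) := by
    by_contra hcon
    push Not at hcon
    have : (univ : Finset V) ⊆ {u, y1, y2} := fun x _ => hcon x
    have := card_le_card this
    rw [card_univ] at this
    have := card_le_three (a := u) (b := y1) (c := y2)
    omega
  simp only [mem_insert, mem_singleton, not_or] at hv3
  have n12 : ¬ H.Adj y1 y2 := by
    intro hadj
    obtain ⟨z, hz, hz' | hz', h⟩ := iso v3 hv3.1
    · subst hz'; exact hv3.2.2 (h y2 hadj).symm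
    · subst hz'; exact hv3.2.1 (h y1 hadj.symm).symm
  have i1 : ∀ y, ¬ H.Adj y1 y := fun y h => n12 (N1 y h ▸ h)
  have i2 : ∀ y, ¬ H.Adj y2 y := fun y h => n12 ((N2 y h ▸ h : H.Adj y2 y1).symm)
  have d1 : dg G y1 = 1 := by
    rw [← hd y1 m1.1]; unfold dg; simp [i1]
  have d2 : dg G y2 = 1 := by
    rw [← hd y2 m2.1]; unfold dg; simp [i2]
  have key : ∀ v, v ∉ ({u, y1, y2} : Finset V) → G.Adj y1 v ∨ G.Adj y2 v := by
    intro v hv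
    simp only [mem_insert, mem_singleton, not_or] at hv
    obtain ⟨τ, h1, h2⟩ := hS.flip v hv.1
    have : ∃ z, z ≠ v ∧ (∀ y, ¬ H.Adj z y) ∧ τ z ≠ u := by
      by_cases h : τ y1 = u
      · exact ⟨y2, Ne.symm hv.2.2, i2, fun h' => hy (τ.injective (h.trans h'.symm))⟩
      · exact ⟨y1, Ne.symm hv.2.1, i1, h⟩
    obtain ⟨z, hzv, hzi, hzu⟩ := this
    have c0 : cdg G v (τ z) = 0 := by
      rw [← cdg_eq h1 h2 hzv]; unfold cdg; simp [hzi]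
    have hdz := hd _ hzu
    have hadj : G.Adj (τ z) v := by
      by_contra hna
      have := cdg_nadj G v _ hna
      omega
    have h3 := cdg_adj G v _ hadj
    have h4 : dg H (τ z) = 0 := by omega
    have h5 : ¬ H.Adj (τ z) u := by
      intro h
      unfold dg at h4
      rw [card_eq_zero] at h4
      have : u ∈ univ.filter (fun x => H.Adj (τ z) x) := by simp [h]
      rw [h4] at this; simp at this
    rcases mem _ hzu h5 with h | h
    · left; rwa [← h]
    · right; rwa [← h]
  have hsub : (univ : Finset V) ⊆ {u, y1, y2} ∪ (univ.filter (fun x => G.Adj y1 x) ∪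
      univ.filter (fun x => G.Adj y2 x)) := by
    intro v _
    by_cases h : v ∈ ({u, y1, y2} : Finset V)
    · exact mem_union_left _ h
    · apply mem_union_right
      simpa using key v h
  have b1 := card_le_card hsub
  have b2 := card_union_le ({u, y1, y2} : Finset V) (univ.filter (fun x => G.Adj y1 x) ∪
      univ.filter (fun x => G.Adj y2 x))
  have b3 := card_union_le (univ.filter (fun x => G.Adj y1 x)) (univ.filter (fun x => G.Adj y2 x))
  have b4 := card_le_three (a := u) (b := y1) (c := y2)
  unfold dg at d1 d2
  rw [card_univ] at b1
  omega

theorem dg_lt {V : Type*} [Fintype V] (G : SimpleGraph V) (v : V) : dg G v < Fintype.card V := by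
  have : univ.filter (fun x => G.Adj v x) ⊆ univ.erase v := by
    intro x hx
    simp only [mem_filter, mem_univ, true_and, mem_erase, and_true] at hx ⊢
    exact hx.ne'
  have h := card_le_card this
  have h2 := card_erase_add_one (mem_univ v)
  rw [card_univ] at h2
  unfold dg
  omega

theorem aux_deg {V : Type*} [Fintype V] {G H : SimpleGraph V} {u : V} (hS : AuxSh G H u)
    (hn : 7 ≤ Fintype.card V) (hG : ∀ x, dg G x + 3 ≤ Fintype.card V) :
    ∀ x, dg G x = dg H x := by
  obtain ⟨e, he⟩ := sum_dg G
  obtain ⟨e', he'⟩ := sum_dg H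
  have hv : ∀ v, v ≠ u → e + dg H v = e' + dg G v := by
    intro v hv
    obtain ⟨τ, h1, h2⟩ := hS v hv
    have a := sum_cdg G v
    have b := sum_cdg H v
    have : ∑ x ∈ univ.erase v, cdg G v x = ∑ x ∈ univ.erase v, cdg H v x := by
      refine sum_equiv τ (fun x => ?_) (fun x hx => ?_)
      · simp only [mem_erase, mem_univ, and_true]; exact (perm_ne h1).symm
      · exact cdg_eq h1 h2 (ne_of_mem_erase hx)
    omega
  have hsum : ∑ v ∈ univ.erase u, (e + dg H v) = ∑ v ∈ univ.erase u, (e' + dg G v) :=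
    sum_congr rfl fun v h => hv v (ne_of_mem_erase h)
  rw [sum_add_distrib, sum_add_distrib, sum_const, sum_const, smul_eq_mul, smul_eq_mul,
    card_erase_of_mem (mem_univ u), card_univ] at hsum
  rw [← add_sum_erase univ _ (mem_univ u)] at he he'
  obtain ⟨m, hm⟩ : ∃ m, Fintype.card V = m + 7 := ⟨Fintype.card V - 7, by omega⟩
  have hG' := hG u
  have hH' := dg_lt H u
  rw [hm] at hsum hG' hH'
  have e1 : ((dg H u : ℤ) - dg G u) = ((e : ℤ) - e') * (m + 4) := by
    have : m + 7 - 1 = m + 6 := rfl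
    rw [this] at hsum
    zify at hsum he he'
    linear_combination he' - he - hsum
  have hle : (e : ℤ) - e' ≤ 1 := by
    by_contra h; push Not at h; nlinarith
  have hge : -1 ≤ (e : ℤ) - e' := by
    by_contra h; push Not at h; nlinarith
  have : (e : ℤ) - e' = -1 ∨ (e : ℤ) - e' = 0 ∨ (e : ℤ) - e' = 1 := by omega
  rcases this with h | h | h
  · exfalso
    rw [h] at e1
    refine aux_E0 hS.flip hn (by omega) (by omega) fun v hvu => ?_
    have := hv v hvu
    omega
  · rw [h] at e1
    intro x
    by_cases hx : x = u
    · subst hx; omega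
    · have := hv x hx; omega
  · exfalso
    rw [h] at e1
    by_cases h0 : dg G u = 0
    · refine aux_E0 hS hn h0 (by omega) fun v hvu => ?_
      have := hv v hvu
      omega
    -- a card of H in which u has degree at least n - 2
    have : ∃ v, v ≠ u ∧ Fintype.card V ≤ cdg H v u + 2 := by
      by_cases hall : ∃ v, v ≠ u ∧ ¬ H.Adj u v
      · obtain ⟨v, hvu, hna⟩ := hall
        exact ⟨v, hvu, by rw [cdg_nadj H v u hna]; omega⟩
      · push Not at hall
        have : 1 < Fintype.card V := by omega
        obtain ⟨v, hvu⟩ := Fintype.exists_ne_of_one_lt_card this u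
        refine ⟨v, hvu, ?_⟩
        have h1 := cdg_adj H v u (hall v hvu)
        have : univ.erase u ⊆ univ.filter (fun x => H.Adj u x) := by
          intro x hx
          simpa using hall x (ne_of_mem_erase hx)
        have h2 := card_le_card this
        have h3 := card_erase_add_one (mem_univ u)
        rw [card_univ] at h3
        have h4 : dg H u = (univ.filter (fun x => H.Adj u x)).card := rfl
        omega
    obtain ⟨v, hvu, hc⟩ := this
    obtain ⟨τ, h1, h2⟩ := hS.flip v hvu
    rw [cdg_eq h1 h2 hvu.symm] at hc
    have := hG (τ u)
    by_cases ha : G.Adj (τ u) v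
    · have := cdg_adj G v _ ha; omega
    · have := cdg_nadj G v _ ha; omega

theorem nonadj_card {V : Type*} [Fintype V] (G : SimpleGraph V) (x : V) :
    (univ.filter (fun v => x ≠ v ∧ ¬ G.Adj x v)).card + dg G x + 1 = Fintype.card V := by
  have h1 : univ.filter (fun v => x ≠ v ∧ ¬ G.Adj x v)
      = (univ.filter (fun v => ¬ G.Adj x v)).erase x := by
    ext; simp [eq_comm]
  have h2 := card_filter_add_card_filter_not (s := (univ : Finset V)) (fun v => G.Adj x v)
  have h3 := card_erase_add_one (s := univ.filter (fun v => ¬ G.Adj x v)) (a := x) (by simp)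
  rw [h1]
  unfold dg
  rw [card_univ] at h2
  omega

theorem aux_main {V : Type*} [Fintype V] {G H : SimpleGraph V} {u : V} (hS : AuxSh G H u)
    (hn : 7 ≤ Fintype.card V) (Δ : ℕ) (hΔ : Δ + 3 ≤ Fintype.card V) (hG : ∀ x, dg G x ≤ Δ)
    (r : ℕ) (hk : kp G r ≠ kp H r) :
    ∀ x y, dg G x = Δ → dg G y = Δ → dr G r x = dr G r y → x = y := by
  have hdeg := aux_deg hS hn (fun x => by have := hG x; omega)
  have hH : ∀ x, dg H x ≤ Δ := fun x => hdeg x ▸ hG x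
  have top : ∀ (K : SimpleGraph V), (∀ x, dg K x ≤ Δ) → ∀ v x,
      (cdg K v x = Δ ↔ dg K x = Δ ∧ ¬ K.Adj x v) := by
    intro K hK v x
    have := hK x
    by_cases h : K.Adj x v
    · have := cdg_adj K v x h
      simp only [h, not_true, and_false, iff_false]; omega
    · rw [cdg_nadj K v x h]; simp [h]
  have hvis : ∀ v, v ≠ u → ∀ (P : ℕ → Prop),
      (univ.filter (fun x => dg G x = Δ ∧ (x ≠ v ∧ ¬ G.Adj x v) ∧ P (dr G r x))).card
      = (univ.filter (fun x => dg G x = Δ ∧ (x ≠ v ∧ ¬ H.Adj x v) ∧ P (dr H r x))).card := by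
    intro v hv P
    obtain ⟨τ, h1, h2⟩ := hS v hv
    refine card_equiv τ fun x => ?_
    simp only [mem_filter, mem_univ, true_and]
    by_cases hx : x = v
    · simp [hx, h1]
    have hx' := (perm_ne h1).2 hx
    have e1 := top G hG v x
    have e2 := top H hH v (τ x)
    rw [← cdg_eq h1 h2 hx] at e2
    rw [hdeg (τ x)]
    constructor
    · rintro ⟨a, ⟨b, c⟩, d⟩
      have hh := e2.1 (e1.2 ⟨a, c⟩)
      exact ⟨hh.1, ⟨hx', hh.2⟩, by rwa [← dr_card h1 h2 r hx c hh.2]⟩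
    · rintro ⟨a, ⟨b, c⟩, d⟩
      have hh := e1.1 (e2.2 ⟨a, c⟩)
      exact ⟨hh.1, ⟨hx, hh.2⟩, by rwa [dr_card h1 h2 r hx hh.2 c]⟩
  have hopen : ∀ v, v ≠ u → dg G v = Δ → ∃ x, (v ≠ x ∧ ¬ G.Adj v x) ∧ ¬ dg G x = Δ := by
    intro v hv hvM
    by_contra hcon
    push Not at hcon
    obtain ⟨τ, h1, h2⟩ := hS v hv
    have hna : ∀ x, x ≠ v → ¬ G.Adj v x → ¬ H.Adj v (τ x) := by
      intro x hx hnx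
      have a := (top G hG v x).2 ⟨hcon x ⟨hx.symm, hnx⟩, fun h => hnx h.symm⟩
      rw [cdg_eq h1 h2 hx] at a
      exact fun h => ((top H hH v _).1 a).2 h.symm
    have hsub : univ.filter (fun y => H.Adj v y) ⊆
        (univ.filter (fun x => G.Adj v x)).map τ.toEmbedding := by
      intro y hy
      simp only [mem_filter, mem_univ, true_and] at hy
      rw [mem_map]
      refine ⟨τ.symm y, ?_, by simp⟩
      simp only [mem_filter, mem_univ, true_and]
      by_contra hc
      refine hna (τ.symm y) ?_ hc (by simpa using hy)
      intro h
      rw [Equiv.symm_apply_eq, h1] at h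
      exact hy.ne h.symm
    have heq := eq_of_subset_of_card_le hsub (by
      rw [card_map]; exact (hdeg v).le)
    have hadj : ∀ x, G.Adj v x ↔ H.Adj v (τ x) := by
      intro x
      constructor
      · intro h
        have : τ x ∈ (univ.filter (fun x => G.Adj v x)).map τ.toEmbedding := by
          rw [mem_map]; exact ⟨x, by simp [h], rfl⟩
        rw [← heq] at this
        simpa using this
      · intro h
        by_contra hc
        refine hna x ?_ hc h
        rintro rfl
        rw [h1] at h
        exact h.ne rfl
    refine hk (kp_iso (τ := τ) (fun x y => ?_) r)
    by_cases hx : x = v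
    · subst hx; rw [h1]; exact hadj y
    by_cases hy : y = v
    · subst hy; rw [h1, G.adj_comm, H.adj_comm]; exact hadj x
    exact h2 x y hx hy
  have hdr : ∀ v, v ≠ u → kp G r + dr H r v = kp H r + dr G r v := by
    intro v hv
    obtain ⟨τ, h1, h2⟩ := hS v hv
    exact kp_dr h1 h2 r
  have cA : ∀ (K : SimpleGraph V), (∀ x, dg G x = dg K x) → ∀ x, dg G x = Δ →
      (univ.filter (fun v => x ≠ v ∧ ¬ K.Adj x v)).card = Fintype.card V - 1 - Δ := by
    intro K hK x hx
    have := nonadj_card K x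
    have := hK x
    omega
  have sy : ∀ (K : SimpleGraph V) x y, (x ≠ y ∧ ¬ K.Adj x y) → (y ≠ x ∧ ¬ K.Adj y x) :=
    fun K x y h => ⟨h.1.symm, fun h' => h.2 h'.symm⟩
  intro x y hx hy hxy
  rcases lt_or_gt_of_ne hk with hlt | hlt
  · exact aux_core (fun x y => x ≠ y ∧ ¬ G.Adj x y) (fun x y => x ≠ y ∧ ¬ H.Adj x y)
      (sy G) (sy H) (fun x => dg G x = Δ) (fun x => -(dr G r x : ℤ)) (fun x => -(dr H r x : ℤ)) u
      ((kp H r : ℤ) - kp G r) (by omega) (fun v hv => by have := hdr v hv; omega)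
      (Fintype.card V - 1 - Δ) (by omega) 
      (fun x hx => by convert cA G (fun _ => rfl) x hx) (fun x hx => by convert cA H hdeg x hx)
      (fun v hv t => by convert hvis v hv (fun k => -(k : ℤ) = t)) hopen x y hx hy (by simp [hxy])
  · exact aux_core (fun x y => x ≠ y ∧ ¬ G.Adj x y) (fun x y => x ≠ y ∧ ¬ H.Adj x y)
      (sy G) (sy H) (fun x => dg G x = Δ) (fun x => (dr G r x : ℤ)) (fun x => (dr H r x : ℤ)) u
      ((kp G r : ℤ) - kp H r) (by omega) (fun v hv => by have := hdr v hv; omega)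
      (Fintype.card V - 1 - Δ) (by omega) 
      (fun x hx => by convert cA G (fun _ => rfl) x hx) (fun x hx => by convert cA H hdeg x hx)
      (fun v hv t => by convert hvis v hv (fun k => (k : ℤ) = t)) hopen x y hx hy (by simp [hxy])

theorem kappa_eq {V : Type*} [Fintype V] (G : SimpleGraph V) (r : ℕ) : kappa G r = kp G r := by
  unfold kappa kp
  rw [← Set.ncard_coe_finset]
  congr 1
  ext s; simp [mem_cliqueSet_iff]

theorem degR_eq {V : Type*} [Fintype V] (G : SimpleGraph V) (r : ℕ) (v : V) :
    degR G r v = dr G r v := by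
  unfold degR dr
  rw [← Set.ncard_coe_finset]
  congr 1
  ext s; simp [mem_cliqueSet_iff]

theorem deg_eq_dg {V : Type*} [Fintype V] (G : SimpleGraph V) (v : V) : deg G v = dg G v := by
  unfold deg dg
  rw [← Set.ncard_coe_finset]
  congr 1
  ext s; simp

theorem extend_perm {V : Type*} [Fintype V] (u w : V) (e : {x : V // x ≠ u} ≃ {y : V // y ≠ w}) :
    ∃ σ : Equiv.Perm V, σ u = w ∧ ∀ x (hx : x ≠ u), σ x = (e ⟨x, hx⟩).1 := by
  refine ⟨e.extendSubtype, ?_, fun x hx => e.extendSubtype_apply_of_mem x hx⟩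
  have := e.extendSubtype_not_mem u (by simp)
  simpa using this

end Aux

theorem distinct_clique_degrees_of_ne {n : ℕ} (hn : 7 ≤ n)
    (G H : SimpleGraph (Fin n)) (hshare : ShareCards G H)
    (hDelta : maxDeg G ≤ n - 3) (r : ℕ) (hr : 2 ≤ r)
    (hk : kappa G r ≠ kappa H r) :
    Set.InjOn (degR G r) {v : Fin n | deg G v = maxDeg G} := by
  obtain ⟨u, w, π, hπ⟩ := hshare
  obtain ⟨σ, hσu, hσ⟩ := extend_perm u w π
  have hS : AuxSh G (H.comap σ) u := by
    intro v hv
    obtain ⟨φ⟩ := hπ ⟨v, hv⟩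
    obtain ⟨ψ, hψv, hψ⟩ := extend_perm v (π ⟨v, hv⟩).1 φ.toEquiv
    refine ⟨ψ.trans σ.symm, ?_, fun x y hx hy => ?_⟩
    · rw [Equiv.trans_apply, Equiv.symm_apply_eq, hψv, hσ v hv]
    · simp only [SimpleGraph.comap_adj, Equiv.trans_apply, Equiv.apply_symm_apply]
      rw [hψ x hx, hψ y hy]
      exact (φ.map_rel_iff (a := ⟨x, hx⟩) (b := ⟨y, hy⟩)).symm
  have hk' : kp G r ≠ kp (H.comap σ) r := by
    rw [kp_iso (G := H.comap σ) (H := H) (τ := σ) (fun x y => Iff.rfl) r, ← kappa_eq, ← kappa_eq]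
    exact hk
  intro x hx y hy hxy
  simp only [Set.mem_setOf_eq, deg_eq_dg] at hx hy
  rw [degR_eq, degR_eq] at hxy
  refine aux_main hS (by simpa using hn) (maxDeg G) (by rw [Fintype.card_fin]; omega) (fun z => ?_)
    r hk' x y hx hy hxy
  rw [← deg_eq_dg]
  exact Finset.le_sup (f := fun v => deg G v) (Finset.mem_univ z)
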